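/- Let M be a po-Γ-semigroup. Every ideal of M is prime if and only if the ideals of M form a chain (i.e., for any two ideals A, B of M, A ⊆ B or B ⊆ A) and M is intra-regular. -/

import Mathlib

namespace PGS

variable {M : Type*} {Γ : Type*}

/-- `AΓB = {aγb : a ∈ A, b ∈ B, γ ∈ Γ}`. -/
def gprod (op : Γ → M → M → M) (A B : Set M) : Set M :=
  {x | ∃ a ∈ A, ∃ b ∈ B, ∃ γ : Γ, x = op γ a b}

/-- `(H] = {t : t ≤ h for some h ∈ H}`. -/
def dcl [PartialOrder M] (H : Set M) : Set M :=
  {t | ∃ h ∈ H, t ≤ h}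

/-- `M` with the family of operations `op : Γ → M → M → M` and the partial order `≤`
is a po-Γ-semigroup: `(aγb)μc = aγ(bμc)` and the order is compatible with the operations. -/
def IsPoGammaSemigroup [PartialOrder M] (op : Γ → M → M → M) : Prop :=
  (∀ (a b c : M) (γ μ : Γ), op μ (op γ a b) c = op γ a (op μ b c)) ∧
  (∀ (a b c : M) (γ : Γ), a ≤ b → op γ a c ≤ op γ b c) ∧
  (∀ (a b c : M) (γ : Γ), a ≤ b → op γ c a ≤ op γ c b)

/-- Left ideal of `M`: `MΓA ⊆ A` and `A` is downward closed. -/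
def IsLeftIdeal [PartialOrder M] (op : Γ → M → M → M) (A : Set M) : Prop :=
  gprod op Set.univ A ⊆ A ∧ ∀ a ∈ A, ∀ b : M, b ≤ a → b ∈ A

/-- Right ideal of `M`: `AΓM ⊆ A` and `A` is downward closed. -/
def IsRightIdeal [PartialOrder M] (op : Γ → M → M → M) (A : Set M) : Prop :=
  gprod op A Set.univ ⊆ A ∧ ∀ a ∈ A, ∀ b : M, b ≤ a → b ∈ A

/-- Ideal of `M`: both a left and a right ideal. -/
def IsIdeal [PartialOrder M] (op : Γ → M → M → M) (A : Set M) : Prop :=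
  IsLeftIdeal op A ∧ IsRightIdeal op A

/-- A prime subset: `aγb ∈ T` implies `a ∈ T` or `b ∈ T`. -/
def IsPrimeSubset (op : Γ → M → M → M) (T : Set M) : Prop :=
  ∀ (a b : M) (γ : Γ), op γ a b ∈ T → a ∈ T ∨ b ∈ T

/-- A semiprime subset: `aγa ∈ T` implies `a ∈ T`. -/
def IsSemiprimeSubset (op : Γ → M → M → M) (T : Set M) : Prop :=
  ∀ (a : M) (γ : Γ), op γ a a ∈ T → a ∈ T

/-- A weakly prime subset: for all ideals `A`, `B` of `M` with `AΓB ⊆ T`,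
`A ⊆ T` or `B ⊆ T`. -/
def IsWeaklyPrimeSubset [PartialOrder M] (op : Γ → M → M → M) (T : Set M) : Prop :=
  ∀ A B : Set M, IsIdeal op A → IsIdeal op B → gprod op A B ⊆ T → A ⊆ T ∨ B ⊆ T

/-- Intra-regular: `x ∈ (MΓ{xγx}ΓM]` for all `x`, `γ`. -/
def IsIntraRegular [PartialOrder M] (op : Γ → M → M → M) : Prop :=
  ∀ (x : M) (γ : Γ),
    x ∈ dcl (gprod op (gprod op Set.univ {op γ x x}) Set.univ)

/-- Left regular: `x ∈ (MΓ{xγx}]` for all `x`, `γ`. -/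
def IsLeftRegular [PartialOrder M] (op : Γ → M → M → M) : Prop :=
  ∀ (x : M) (γ : Γ), x ∈ dcl (gprod op Set.univ {op γ x x})

/-- Left duo: every left ideal of `M` is an ideal of `M`. -/
def IsLeftDuo [PartialOrder M] (op : Γ → M → M → M) : Prop :=
  ∀ A : Set M, IsLeftIdeal op A → IsIdeal op A

/-- A subsemigroup: a nonempty subset `T` with `TΓT ⊆ T`. -/
def IsSubsemigroup (op : Γ → M → M → M) (T : Set M) : Prop :=
  T.Nonempty ∧ gprod op T T ⊆ T

/-- An ideal of a subsemigroup `T`: a nonempty subset `I` of `T` with `TΓI ⊆ I`,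
`IΓT ⊆ I`, closed downward inside `T`. -/
def IsIdealOfSub [PartialOrder M] (op : Γ → M → M → M) (T I : Set M) : Prop :=
  I.Nonempty ∧ I ⊆ T ∧ gprod op T I ⊆ I ∧ gprod op I T ⊆ I ∧
    ∀ a ∈ I, ∀ b ∈ T, b ≤ a → b ∈ I

/-- A left ideal of a subsemigroup `T`: a nonempty subset `I` of `T` with `TΓI ⊆ I`,
closed downward inside `T`. -/
def IsLeftIdealOfSub [PartialOrder M] (op : Γ → M → M → M) (T I : Set M) : Prop :=
  I.Nonempty ∧ I ⊆ T ∧ gprod op T I ⊆ I ∧ ∀ a ∈ I, ∀ b ∈ T, b ≤ a → b ∈ I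

/-- A simple subsemigroup: a subsemigroup having no ideal other than itself. -/
def IsSimpleSub [PartialOrder M] (op : Γ → M → M → M) (T : Set M) : Prop :=
  IsSubsemigroup op T ∧ ∀ I : Set M, IsIdealOfSub op T I → I = T

/-- A left simple subsemigroup: a subsemigroup having no left ideal other than itself. -/
def IsLeftSimpleSub [PartialOrder M] (op : Γ → M → M → M) (T : Set M) : Prop :=
  IsSubsemigroup op T ∧ ∀ I : Set M, IsLeftIdealOfSub op T I → I = T

/-- A filter of `M`: a subsemigroup `F` such that `aγb ∈ F` implies `a ∈ F` and `b ∈ F`,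
and `F` is upward closed. -/
def IsFilterSub [PartialOrder M] (op : Γ → M → M → M) (F : Set M) : Prop :=
  IsSubsemigroup op F ∧ (∀ (a b : M) (γ : Γ), op γ a b ∈ F → a ∈ F ∧ b ∈ F) ∧
    ∀ a ∈ F, ∀ c : M, a ≤ c → c ∈ F

/-- `N(x)`: the least filter of `M` containing `x`. -/
def Nfil [PartialOrder M] (op : Γ → M → M → M) (x : M) : Set M :=
  ⋂₀ {F : Set M | IsFilterSub op F ∧ x ∈ F}

/-- The `𝒩`-class `(x)_𝒩` of `x`, where `a 𝒩 b` iff `N(a) = N(b)`. -/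
def Ncls [PartialOrder M] (op : Γ → M → M → M) (x : M) : Set M :=
  {y | Nfil op y = Nfil op x}

/-- `L(a) = ({a} ∪ MΓ{a}]`, the left ideal of `M` generated by `a`. -/
def Lgen [PartialOrder M] (op : Γ → M → M → M) (a : M) : Set M :=
  dcl ({a} ∪ gprod op Set.univ {a})

/-- `I(a) = ({a} ∪ MΓ{a} ∪ {a}ΓM ∪ MΓ{a}ΓM]`, the ideal of `M` generated by `a`. -/
def Igen [PartialOrder M] (op : Γ → M → M → M) (a : M) : Set M :=
  dcl ({a} ∪ gprod op Set.univ {a} ∪ gprod op {a} Set.univ ∪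
    gprod op (gprod op Set.univ {a}) Set.univ)

/-- A semilattice congruence on `M`. -/
def IsSemilatticeCong (op : Γ → M → M → M) (σ : M → M → Prop) : Prop :=
  Equivalence σ ∧
  (∀ (a b c : M) (γ : Γ), σ a b → σ (op γ a c) (op γ b c)) ∧
  (∀ (a b c : M) (γ : Γ), σ a b → σ (op γ c a) (op γ c b)) ∧
  (∀ (a b : M) (γ : Γ), σ (op γ a b) (op γ b a)) ∧
  (∀ (a : M) (γ : Γ), σ (op γ a a) a)

/-- The `σ`-class of `x`. -/
def cls (σ : M → M → Prop) (x : M) : Set M := {y | σ y x}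

/-- `M` is a semilattice of simple semigroups. -/
def IsSemilatticeOfSimple [PartialOrder M] (op : Γ → M → M → M) : Prop :=
  ∃ σ : M → M → Prop, IsSemilatticeCong op σ ∧ ∀ x : M, IsSimpleSub op (cls σ x)

/-- `M` is a semilattice of left simple semigroups. -/
def IsSemilatticeOfLeftSimple [PartialOrder M] (op : Γ → M → M → M) : Prop :=
  ∃ σ : M → M → Prop, IsSemilatticeCong op σ ∧ ∀ x : M, IsLeftSimpleSub op (cls σ x)

/-- `M` is a chain of simple semigroups. -/
def IsChainOfSimple [PartialOrder M] (op : Γ → M → M → M) : Prop :=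
  ∃ σ : M → M → Prop, IsSemilatticeCong op σ ∧ (∀ x : M, IsSimpleSub op (cls σ x)) ∧
    ∀ (x y : M) (γ : Γ), cls σ x = cls σ (op γ x y) ∨ cls σ y = cls σ (op γ x y)


theorem IsIdeal.op_mem_left [PartialOrder M] {op : Γ → M → M → M} {T : Set M}
    (hT : IsIdeal op T) (c : M) {a : M} (ha : a ∈ T) (γ : Γ) : op γ c a ∈ T :=
  hT.1.1 ⟨c, trivial, a, ha, γ, rfl⟩

theorem IsIdeal.op_mem_right [PartialOrder M] {op : Γ → M → M → M} {T : Set M}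
    (hT : IsIdeal op T) (c : M) {a : M} (ha : a ∈ T) (γ : Γ) : op γ a c ∈ T :=
  hT.2.1 ⟨a, ha, c, trivial, γ, rfl⟩

theorem IsIdeal.mem_of_le [PartialOrder M] {op : Γ → M → M → M} {T : Set M}
    (hT : IsIdeal op T) {a b : M} (ha : a ∈ T) (hb : b ≤ a) : b ∈ T :=
  hT.1.2 a ha b hb

theorem IsIdeal.of_closed [PartialOrder M] {op : Γ → M → M → M} {T : Set M}
    (hl : ∀ (c : M), ∀ a ∈ T, ∀ γ : Γ, op γ c a ∈ T)
    (hr : ∀ (c : M), ∀ a ∈ T, ∀ γ : Γ, op γ a c ∈ T)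
    (hd : ∀ a ∈ T, ∀ b : M, b ≤ a → b ∈ T) : IsIdeal op T := by
  refine ⟨⟨?_, hd⟩, ?_, hd⟩
  · rintro _ ⟨c, -, a, ha, γ, rfl⟩
    exact hl c a ha γ
  · rintro _ ⟨a, ha, c, -, γ, rfl⟩
    exact hr c a ha γ

theorem IsIdeal.inter [PartialOrder M] {op : Γ → M → M → M} {A B : Set M}
    (hA : IsIdeal op A) (hB : IsIdeal op B) : IsIdeal op (A ∩ B) :=
  .of_closed
    (fun c _ ha γ => ⟨hA.op_mem_left c ha.1 γ, hB.op_mem_left c ha.2 γ⟩)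
    (fun c _ ha γ => ⟨hA.op_mem_right c ha.1 γ, hB.op_mem_right c ha.2 γ⟩)
    (fun _ ha _ hb => ⟨hA.mem_of_le ha.1 hb, hB.mem_of_le ha.2 hb⟩)

theorem mem_dcl_gprod_gprod_iff [PartialOrder M] {op : Γ → M → M → M} {x a : M} :
    x ∈ dcl (gprod op (gprod op Set.univ {a}) Set.univ) ↔
      ∃ (u v : M) (α β : Γ), x ≤ op β (op α u a) v := by
  constructor
  · rintro ⟨_, ⟨_, ⟨u, -, _, rfl, α, rfl⟩, v, -, β, rfl⟩, h⟩
    exact ⟨u, v, α, β, h⟩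
  · rintro ⟨u, v, α, β, h⟩
    exact ⟨_, ⟨_, ⟨u, trivial, a, rfl, α, rfl⟩, v, trivial, β, rfl⟩, h⟩

theorem isIdeal_dcl_gprod_gprod [PartialOrder M] {op : Γ → M → M → M}
    (hM : IsPoGammaSemigroup op) (a : M) :
    IsIdeal op (dcl (gprod op (gprod op Set.univ {a}) Set.univ)) := by
  obtain ⟨assoc, mono_left, mono_right⟩ := hM
  refine .of_closed ?_ ?_ ?_ <;> simp only [mem_dcl_gprod_gprod_iff]
  · rintro c x ⟨u, v, α, β, h⟩ γ
    refine ⟨op γ c u, v, α, β, (mono_right _ _ c γ h).trans_eq ?_⟩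
    simp only [assoc]
  · rintro c x ⟨u, v, α, β, h⟩ γ
    refine ⟨u, op γ v c, α, β, (mono_left _ _ c γ h).trans_eq ?_⟩
    simp only [assoc]
  · rintro x ⟨u, v, α, β, h⟩ y hy
    exact ⟨u, v, α, β, hy.trans h⟩

theorem IsIntraRegular.mem_dcl_gprod_gprod [PartialOrder M] [Nonempty Γ]
    {op : Γ → M → M → M} (hM : IsPoGammaSemigroup op) (hI : IsIntraRegular op) (a : M) :
    a ∈ dcl (gprod op (gprod op Set.univ {a}) Set.univ) := by
  obtain ⟨γ⟩ := ‹Nonempty Γ›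
  obtain ⟨u, v, α, β, h⟩ := mem_dcl_gprod_gprod_iff.1 (hI a γ)
  refine mem_dcl_gprod_gprod_iff.2 ⟨u, op β a v, α, γ, h.trans_eq ?_⟩
  simp only [hM.1]

theorem IsIntraRegular.isSemiprimeSubset [PartialOrder M] {op : Γ → M → M → M}
    (hI : IsIntraRegular op) {T : Set M} (hT : IsIdeal op T) : IsSemiprimeSubset op T := by
  intro x γ hx
  obtain ⟨u, v, α, β, h⟩ := mem_dcl_gprod_gprod_iff.1 (hI x γ)
  exact hT.mem_of_le (hT.op_mem_right v (hT.op_mem_left u hx α) β) h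

theorem IsSemiprimeSubset.op_swap_mem [PartialOrder M] {op : Γ → M → M → M}
    (hM : IsPoGammaSemigroup op) {T : Set M} (hT : IsIdeal op T)
    (hS : IsSemiprimeSubset op T) {a b : M} {γ : Γ} (h : op γ a b ∈ T) (μ : Γ) :
    op μ b a ∈ T := by
  have key : op γ (op μ b a) (op μ b a) = op μ (op μ b (op γ a b)) a := by simp only [hM.1]
  exact hS _ γ (key ▸ hT.op_mem_right a (hT.op_mem_left b h μ) μ)

theorem IsSemiprimeSubset.mem_of_op_mem [PartialOrder M] {op : Γ → M → M → M}
    (hM : IsPoGammaSemigroup op) {T : Set M} (hT : IsIdeal op T)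
    (hS : IsSemiprimeSubset op T) {a b : M} {γ : Γ} (h : op γ a b ∈ T)
    (hb : b ∈ dcl (gprod op (gprod op Set.univ {a}) Set.univ)) : b ∈ T := by
  obtain ⟨u, v, α, β, hb⟩ := mem_dcl_gprod_gprod_iff.1 hb
  have hbu : op γ a (op γ b u) ∈ T := hM.1 a b u γ γ ▸ hT.op_mem_right u h γ
  have hbua : op β (op α (op γ b u) a) v ∈ T :=
    hT.op_mem_right v (hS.op_swap_mem hM hT hbu α) β
  refine hS b γ (hT.mem_of_le hbua ((hM.2.2 _ _ b γ hb).trans_eq ?_))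
  simp only [hM.1]

theorem statement_12 [PartialOrder M] [Nonempty M] [Nonempty Γ]
    (op : Γ → M → M → M) (hM : IsPoGammaSemigroup op) :
    (∀ T : Set M, IsIdeal op T → IsPrimeSubset op T) ↔
      ((∀ A B : Set M, IsIdeal op A → IsIdeal op B → A ⊆ B ∨ B ⊆ A) ∧
        IsIntraRegular op) := by
  constructor
  · intro hP
    refine ⟨fun A B hA hB => ?_, fun x γ => ?_⟩
    · by_contra! hne
      obtain ⟨a, haA, haB⟩ := Set.not_subset.1 hne.1
      obtain ⟨b, hbB, hbA⟩ := Set.not_subset.1 hne.2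
      obtain ⟨γ⟩ := ‹Nonempty Γ›
      rcases hP _ (hA.inter hB) a b γ ⟨hA.op_mem_right b haA γ, hB.op_mem_left a hbB γ⟩
        with h | h
      · exact haB h.2
      · exact hbA h.1
    · have hT := hP _ (isIdeal_dcl_gprod_gprod hM (op γ x x))
      have hmem := mem_dcl_gprod_gprod_iff.2
        ⟨x, x, γ, γ, le_refl (op γ (op γ x (op γ x x)) x)⟩
      rcases hT _ _ _ hmem with h | h
      · rcases hT _ _ _ h with h | h
        · exact h
        · exact (hT _ _ _ h).elim id id
      · exact h
  · rintro ⟨hC, hI⟩ T hT a b γ hab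
    have hS := hI.isSemiprimeSubset hT
    rcases hC _ _ (isIdeal_dcl_gprod_gprod hM a) (isIdeal_dcl_gprod_gprod hM b) with h | h
    · exact .inl (hS.mem_of_op_mem hM hT (hS.op_swap_mem hM hT hab γ)
        (h (hI.mem_dcl_gprod_gprod hM a)))
    · exact .inr (hS.mem_of_op_mem hM hT hab (h (hI.mem_dcl_gprod_gprod hM b)))

end PGS
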